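/- arXiv:1311.4450 — 2 statements merged into one kernel-verified Lean document; each statement's English description precedes it below -/
import Mathlib

section
/- Let X be a δ-hyperbolike graph with base vertex x. Then the growth series b_x(t) = Σ_{n≥0} |X_n| tⁿ, whose n-th coefficient is the number of vertices at distance at most n from x, is a rational power series. -/
open SimpleGraph Filter

namespace CF

variable {V : Type*}

/-- A walk in a graph is a geodesic if its length realizes the graph distance
between its endpoints. -/
def IsGeodesic (G : SimpleGraph V) {u v : V} (p : G.Walk u v) : Prop :=
  p.length = G.dist u v

/-- `G` is δ-hyperbolic: every geodesic triangle is δ-thin, i.e. each side lies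
in the δ-neighborhood of the union of the other two sides. -/
def IsDeltaHyperbolic (G : SimpleGraph V) (δ : ℝ) : Prop :=
  ∀ ⦃a b c : V⦄ (p : G.Walk a b) (q : G.Walk b c) (r : G.Walk a c),
    IsGeodesic G p → IsGeodesic G q → IsGeodesic G r →
      (∀ z ∈ p.support, ∃ w, (w ∈ q.support ∨ w ∈ r.support) ∧ (G.dist z w : ℝ) ≤ δ) ∧
      (∀ z ∈ q.support, ∃ w, (w ∈ p.support ∨ w ∈ r.support) ∧ (G.dist z w : ℝ) ≤ δ) ∧
      (∀ z ∈ r.support, ∃ w, (w ∈ p.support ∨ w ∈ q.support) ∧ (G.dist z w : ℝ) ≤ δ)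

/-- `G` has uniformly finite valence. -/
def UnifFiniteValence (G : SimpleGraph V) : Prop :=
  ∃ D : ℕ, ∀ v : V, (G.neighborSet v).Finite ∧ (G.neighborSet v).ncard ≤ D

/-- The automorphism group of `G` acts transitively on vertices. -/
def VertexTransitive (G : SimpleGraph V) : Prop :=
  ∀ u v : V, ∃ φ : G ≃g G, φ u = v

/-- A δ-hyperbolike graph: connected, of uniformly finite valence, δ-hyperbolic
(with δ ≥ 0), and vertex-transitive. -/
def Hyperbolike (G : SimpleGraph V) (δ : ℝ) : Prop :=
  G.Connected ∧ UnifFiniteValence G ∧ 0 ≤ δ ∧ IsDeltaHyperbolic G δ ∧ VertexTransitive G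

/-- The ball of radius `n` about `x` (as a vertex set). -/
def ball (G : SimpleGraph V) (x : V) (n : ℕ) : Set V := {y | G.dist x y ≤ n}

/-- A formal power series over ℝ is rational if `q·P = p` for polynomials `p`, `q`
with `q(0) ≠ 0`. -/
def IsRationalPS (P : PowerSeries ℝ) : Prop :=
  ∃ p q : Polynomial ℝ, q.coeff 0 ≠ 0 ∧ (q : PowerSeries ℝ) * P = (p : PowerSeries ℝ)

/-- Two geodesics starting at the same point `T`-synchronously fellow travel:
`d(γ(ℓ−i), γ′(ℓ′−i)) ≤ T` for all `0 ≤ i ≤ min(ℓ,ℓ′)`. -/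
def SyncFellowTravel (G : SimpleGraph V) (T : ℝ) {x y z : V}
    (p : G.Walk x y) (q : G.Walk x z) : Prop :=
  ∀ i : ℕ, i ≤ min p.length q.length →
    (G.dist (p.getVert (p.length - i)) (q.getVert (q.length - i)) : ℝ) ≤ T

/-- `z` is a competitor of `y` (with respect to the base point `x`):
`z ∈ B_{2δ+1}(y)`, `d(x,z) ≤ d(x,y)`, and some geodesic from `x` to `z`
`(2δ+1)`-synchronously fellow travels every geodesic from `x` to `y`. -/
def Competitor (G : SimpleGraph V) (δ : ℝ) (x y z : V) : Prop :=
  (G.dist y z : ℝ) ≤ 2*δ+1 ∧ G.dist x z ≤ G.dist x y ∧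
  ∃ p : G.Walk x z, IsGeodesic G p ∧
    ∀ q : G.Walk x y, IsGeodesic G q → SyncFellowTravel G (2*δ+1) p q

/-- `F` is a tournament at `y` (with base point `x`); only the values of `F` on
the ball `B_{2δ+1}(y)` are constrained. -/
def Tournament (G : SimpleGraph V) (δ : ℝ) (x y : V) (F : V → ℤ) : Prop :=
  (∀ z : V, (G.dist y z : ℝ) ≤ 2*δ+1 →
    (G.dist x z : ℤ) - (G.dist x y : ℤ) ≤ F z ∧ F z ≤ (G.dist y z : ℤ)) ∧
  (∀ z : V, Competitor G δ x y z → (G.dist x z : ℤ) = (G.dist x y : ℤ) + F z)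

/-- Tournaments `(y,F)` and `(y',F')` have the same type: some automorphism `φ`
carries `y` to `y'` with `F = F' ∘ φ` (on the ball `B_{2δ+1}(y)`). -/
def SameTournamentType (G : SimpleGraph V) (δ : ℝ) (y y' : V) (F F' : V → ℤ) : Prop :=
  ∃ φ : G ≃g G, φ y = y' ∧ ∀ z : V, (G.dist y z : ℝ) ≤ 2*δ+1 → F z = F' (φ z)

/-- The cone of `y` with respect to the base point `x`. -/
def cone (G : SimpleGraph V) (x y : V) : Set V :=
  {z | G.dist x z = G.dist x y + G.dist y z}

/-- There is a quasi-isometry from the vertices of `G` (with the path metric) to ℝ. -/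
def QuasiIsometricToReal (G : SimpleGraph V) : Prop :=
  ∃ (f : V → ℝ) (C : ℝ), 1 ≤ C ∧
    (∀ u v : V, (G.dist u v : ℝ)/C - C ≤ |f u - f v| ∧ |f u - f v| ≤ C * G.dist u v + C) ∧
    (∀ r : ℝ, ∃ v : V, |r - f v| ≤ C)

/-- `G` is nonelementary: infinitely many vertices and not quasi-isometric to ℝ. -/
def Nonelementary (G : SimpleGraph V) : Prop :=
  Infinite V ∧ ¬ QuasiIsometricToReal G

/-- `ω` is an opposite series of the power series with (positive) coefficients `a`:
the polynomials `Xₙ(P)(s) = Σ_{k≤n} (a_{n-k}/aₙ) s^k` accumulate coefficientwise at `ω`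
along some strictly increasing sequence of indices. -/
def OppositeSeries (a : ℕ → ℝ) (ω : ℕ → ℝ) : Prop :=
  ∃ φ : ℕ → ℕ, StrictMono φ ∧
    ∀ k : ℕ, Tendsto (fun j => a (φ j - k) / a (φ j)) atTop (nhds (ω k))

end CF

namespace CF

section Rationality

variable {G : SimpleGraph V}

/-- A sequence lying in a finite-dimensional shift-invariant space of sequences has a
rational generating function. -/
theorem isRationalPS_of_mem_shift_invariant (W : Submodule ℝ (ℕ → ℝ)) [FiniteDimensional ℝ W]
    (hW : ∀ s ∈ W, (fun n => s (n + 1)) ∈ W) {s : ℕ → ℝ} (hs : s ∈ W) :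
    IsRationalPS (PowerSeries.mk s) := by
  let T : (ℕ → ℝ) →ₗ[ℝ] (ℕ → ℝ) := LinearMap.funLeft ℝ ℝ (fun n => n + 1)
  have hT : ∀ s ∈ W, T s ∈ W := hW
  have hpow : ∀ (i : ℕ) (s : ℕ → ℝ) (n : ℕ), (T ^ i) s n = s (n + i) := by
    intro i
    induction i with
    | zero => intro s n; simp
    | succ i ih =>
      intro s n
      rw [pow_succ, Module.End.mul_apply, ih]
      simp [T, LinearMap.funLeft_apply, add_assoc]
  set f := (T.restrict hT).charpoly with hf
  have hmonic : f.Monic := LinearMap.charpoly_monic _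
  set d := f.natDegree with hd
  have hrec : ∀ n, ∑ i ∈ Finset.range (d + 1), f.coeff i * s (n + i) = 0 := by
    intro n
    have h := LinearMap.aeval_self_charpoly (T.restrict hT)
    rw [← hf, Polynomial.aeval_eq_sum_range] at h
    have h2 := congrArg (fun L : W →ₗ[ℝ] W => ((L ⟨s, hs⟩ : W) : ℕ → ℝ) n) h
    have hcoe : ∀ i, ((((T.restrict hT) ^ i) ⟨s, hs⟩ : W) : ℕ → ℝ) n = s (n + i) := by
      intro i
      rw [Module.End.pow_restrict, LinearMap.coe_restrict_apply, hpow]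
    simp only [LinearMap.sum_apply, LinearMap.smul_apply, Submodule.coe_sum, Submodule.coe_smul,
      Finset.sum_apply, Pi.smul_apply, smul_eq_mul, hcoe, LinearMap.zero_apply,
      Submodule.coe_zero, Pi.zero_apply] at h2
    exact h2
  let q : Polynomial ℝ :=
    ∑ i ∈ Finset.range (d + 1), Polynomial.C (f.coeff i) * Polynomial.X ^ (d - i)
  have hcoeff : ∀ m, PowerSeries.coeff m ((q : PowerSeries ℝ) * PowerSeries.mk s) =
      ∑ i ∈ Finset.range (d + 1), f.coeff i * (if d - i ≤ m then s (m - (d - i)) else 0) := by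
    intro m
    have hq : (q : PowerSeries ℝ) = ∑ i ∈ Finset.range (d + 1),
        PowerSeries.C (f.coeff i) * PowerSeries.X ^ (d - i) := by
      rw [← Polynomial.coeToPowerSeries.ringHom_apply, map_sum]
      simp
    rw [hq, Finset.sum_mul, map_sum]
    refine Finset.sum_congr rfl fun i _ => ?_
    rw [mul_assoc, PowerSeries.coeff_C_mul, PowerSeries.coeff_X_pow_mul']
    simp
  refine ⟨PowerSeries.trunc d ((q : PowerSeries ℝ) * PowerSeries.mk s), q, ?_, ?_⟩
  · have : q.coeff 0 = 1 := by
      simp only [q, Polynomial.finsetSum_coeff, Polynomial.coeff_C_mul, Polynomial.coeff_X_pow]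
      rw [Finset.sum_eq_single d]
      · rw [Nat.sub_self, if_pos rfl, mul_one]
        exact hmonic.coeff_natDegree
      · intro i hi hne
        have := Finset.mem_range.1 hi
        rw [if_neg (by omega), mul_zero]
      · simp
    rw [this]; exact one_ne_zero
  · ext m
    rw [Polynomial.coeff_coe, PowerSeries.coeff_trunc]
    split_ifs with hm
    · rfl
    · rw [hcoeff, ← hrec (m - d)]
      refine Finset.sum_congr rfl fun i hi => ?_
      have := Finset.mem_range.1 hi
      rw [if_pos (by omega)]
      congr 2
      omega

/-- Rationality passes from a sequence to its sequence of partial sums. -/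
theorem IsRationalPS.partial_sums {s b : ℕ → ℝ} (hs : IsRationalPS (PowerSeries.mk s))
    (h0 : b 0 = s 0) (hb : ∀ n, b (n + 1) = b n + s (n + 1)) :
    IsRationalPS (PowerSeries.mk b) := by
  obtain ⟨p, q, hq, h⟩ := hs
  refine ⟨p, q * (1 - Polynomial.X), by simpa [Polynomial.mul_coeff_zero] using hq, ?_⟩
  have key : (1 - PowerSeries.X : PowerSeries ℝ) * PowerSeries.mk b = PowerSeries.mk s := by
    ext n
    rw [sub_mul, one_mul, map_sub]
    cases n with
    | zero => simp [h0]
    | succ n => simp [PowerSeries.coeff_succ_X_mul, hb]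
  rw [← h, ← key, Polynomial.coe_mul, mul_assoc]
  simp

theorem dist_add_dist_of_mem_support {x a z : V} {p : G.Walk x a} (hconn : G.Connected)
    (hp : IsGeodesic G p) (hz : z ∈ p.support) : G.dist x a = G.dist x z + G.dist z a := by
  classical
  have h1 := G.dist_le (p.takeUntil z hz)
  have h2 := G.dist_le (p.dropUntil z hz)
  have h3 := congrArg Walk.length (p.take_spec hz)
  rw [Walk.length_append] at h3
  have h4 : G.dist x a ≤ G.dist x z + G.dist z a := hconn.dist_triangle
  have h5 : p.length = G.dist x a := hp
  omega

theorem dist_iso (hconn : G.Connected) (φ : G ≃g G) (u v : V) :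
    G.dist (φ u) (φ v) = G.dist u v := by
  have key : ∀ (ψ : G ≃g G) (u v : V), G.dist (ψ u) (ψ v) ≤ G.dist u v := by
    intro ψ u v
    obtain ⟨p, hp⟩ := hconn.exists_walk_length_eq_dist u v
    have := G.dist_le (p.map ψ.toHom)
    rw [Walk.length_map, hp] at this
    exact this
  refine le_antisymm (key φ u v) ?_
  simpa using key φ.symm (φ u) (φ v)

/-- A geodesic to a neighbour of a point in the cone of `y` passes near `y`. -/
theorem exists_near_of_mem_cone {δ : ℝ} {R : ℕ} (hconn : G.Connected)
    (hδ : IsDeltaHyperbolic G δ) (hR : δ + 1 ≤ R) {x y a b : V} (ha : a ∈ cone G x y)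
    (hab : G.Adj a b) : ∃ u, G.dist y u ≤ R ∧ G.dist x b = G.dist x u + G.dist u b := by
  obtain ⟨p₁, hp₁⟩ := hconn.exists_walk_length_eq_dist x y
  obtain ⟨p₂, hp₂⟩ := hconn.exists_walk_length_eq_dist y a
  obtain ⟨r, hr⟩ := hconn.exists_walk_length_eq_dist x b
  have ha' : G.dist x a = G.dist x y + G.dist y a := ha
  have hab1 : G.dist a b = 1 := dist_eq_one_iff_adj.2 hab
  have hp : IsGeodesic G (p₁.append p₂) := by
    rw [IsGeodesic, Walk.length_append]; omega
  have hq : IsGeodesic G hab.toWalk := by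
    rw [IsGeodesic, hab1]; simp
  have hy : y ∈ (p₁.append p₂).support := by simp
  obtain ⟨w, hw, hyw⟩ := (hδ (p₁.append p₂) hab.toWalk r hp hq hr).1 y hy
  have hb : G.dist y b ≤ R → ∃ u, G.dist y u ≤ R ∧ G.dist x b = G.dist x u + G.dist u b :=
    fun h => ⟨b, h, by simp⟩
  rcases hw with hw | hw
  · have hw' : w = a ∨ w = b := by simpa using hw
    apply hb
    rcases hw' with rfl | rfl
    · have h1 : G.dist y b ≤ G.dist y w + G.dist w b := hconn.dist_triangle
      have h2 : (G.dist y b : ℝ) ≤ G.dist y w + 1 := by rw [hab1] at h1; exact_mod_cast h1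
      exact_mod_cast (by linarith : (G.dist y b : ℝ) ≤ R)
    · exact_mod_cast (by linarith : (G.dist y w : ℝ) ≤ R)
  · exact ⟨w, by exact_mod_cast (by linarith : (G.dist y w : ℝ) ≤ R),
      dist_add_dist_of_mem_support hconn hr hw⟩

theorem exists_adj_dist_add_one (hconn : G.Connected) {x y : V} (h : G.dist x y ≠ 0) :
    ∃ v, G.Adj v y ∧ G.dist x v + 1 = G.dist x y := by
  obtain ⟨p, hp⟩ := hconn.exists_walk_length_eq_dist x y
  have hnil : ¬ p.Nil := by
    rw [← Walk.length_eq_zero_iff]; omega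
  have hadj := p.adj_penultimate hnil
  refine ⟨p.penultimate, hadj, ?_⟩
  have h1 : G.dist x y = G.dist x p.penultimate + G.dist p.penultimate y :=
    dist_add_dist_of_mem_support hconn hp (p.getVert_mem_support _)
  rw [dist_eq_one_iff_adj.2 hadj] at h1
  exact h1.symm

theorem finite_ball (hconn : G.Connected) (hfin : ∀ v, (G.neighborSet v).Finite) (x : V)
    (n : ℕ) : (ball G x n).Finite := by
  induction n with
  | zero =>
    refine (Set.finite_singleton x).subset fun y hy => ?_
    have : G.dist x y = 0 := Nat.le_zero.1 hy
    exact ((hconn.dist_eq_zero_iff).1 this).symm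
  | succ n ih =>
    refine (ih.union (ih.biUnion fun v _ => hfin v)).subset fun y hy => ?_
    have hy' : G.dist x y ≤ n + 1 := hy
    by_cases h : G.dist x y ≤ n
    · exact Or.inl h
    · right
      obtain ⟨v, hv, hvy⟩ := exists_adj_dist_add_one hconn (x := x) (y := y) (by omega)
      exact Set.mem_biUnion (show G.dist x v ≤ n by omega) hv

/-- `φ` carries the distances to `x`, relative to that of `y`, on the ball of radius `R` about
`y` to the corresponding relative distances about `φ y`. -/
def PreservesLevels (G : SimpleGraph V) (x y : V) (R : ℕ) (φ : G ≃g G) : Prop :=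
  ∀ u, G.dist y u ≤ R →
    (G.dist x (φ u) : ℤ) - G.dist x (φ y) = (G.dist x u : ℤ) - G.dist x y

theorem PreservesLevels.symm (hconn : G.Connected) {x y : V} {R : ℕ} {φ : G ≃g G}
    (h : PreservesLevels G x y R φ) : PreservesLevels G x (φ y) R φ.symm := by
  intro u hu
  have hu' : G.dist y (φ.symm u) ≤ R := by
    rw [← dist_iso hconn φ]; simpa using hu
  have := h _ hu'
  simp only [RelIso.apply_symm_apply, RelIso.symm_apply_apply] at this ⊢
  omega

theorem PreservesLevels.dist_le_of_adj {δ : ℝ} {R : ℕ} (hconn : G.Connected)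
    (hδ : IsDeltaHyperbolic G δ) (hR : δ + 1 ≤ R) {x y a b : V} {φ : G ≃g G}
    (hφ : PreservesLevels G x y R φ) (ha : a ∈ cone G x y) (hab : G.Adj a b) :
    (G.dist x (φ b) : ℤ) - G.dist x (φ y) ≤ (G.dist x b : ℤ) - G.dist x y := by
  obtain ⟨u, hu, hub⟩ := exists_near_of_mem_cone hconn hδ hR ha hab
  have h1 := hφ u hu
  have h2 : G.dist x (φ b) ≤ G.dist x (φ u) + G.dist (φ u) (φ b) := hconn.dist_triangle
  rw [dist_iso hconn] at h2
  omega

theorem PreservesLevels.dist_eq_of_adj {δ : ℝ} {R : ℕ} (hconn : G.Connected)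
    (hδ : IsDeltaHyperbolic G δ) (hR : δ + 1 ≤ R) {x y a b : V} {φ : G ≃g G}
    (hφ : PreservesLevels G x y R φ) (ha : a ∈ cone G x y) (ha' : φ a ∈ cone G x (φ y))
    (hab : G.Adj a b) :
    (G.dist x (φ b) : ℤ) - G.dist x (φ y) = (G.dist x b : ℤ) - G.dist x y := by
  refine le_antisymm (hφ.dist_le_of_adj hconn hδ hR ha hab) ?_
  have := (hφ.symm hconn).dist_le_of_adj hconn hδ hR ha' (φ.map_adj_iff.2 hab)
  simpa using this

theorem PreservesLevels.map_mem_cone {δ : ℝ} {R : ℕ} (hconn : G.Connected)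
    (hδ : IsDeltaHyperbolic G δ) (hR : δ + 1 ≤ R) {x y a : V} {φ : G ≃g G}
    (hφ : PreservesLevels G x y R φ) (ha : a ∈ cone G x y) : φ a ∈ cone G x (φ y) := by
  induction hm : G.dist y a generalizing a with
  | zero =>
    obtain rfl := hconn.dist_eq_zero_iff.1 hm
    simp [cone]
  | succ m ih =>
    obtain ⟨v, hva, hv⟩ := exists_adj_dist_add_one hconn (x := y) (y := a) (by omega)
    have ha' : G.dist x a = G.dist x y + G.dist y a := ha
    have hvc : v ∈ cone G x y := by
      have h1 : G.dist x a ≤ G.dist x v + G.dist v a := hconn.dist_triangle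
      have h2 : G.dist x v ≤ G.dist x y + G.dist y v := hconn.dist_triangle
      rw [dist_eq_one_iff_adj.2 hva] at h1
      change G.dist x v = _
      omega
    have h3 := hφ.dist_eq_of_adj hconn hδ hR hvc (ih hvc (by omega)) hva
    change G.dist x (φ a) = G.dist x (φ y) + G.dist (φ y) (φ a)
    rw [dist_iso hconn]
    omega

section Weights

variable [G.LocallyFinite]

open scoped Classical in
/-- The neighbours of `z` that are one step further from `x`. -/
noncomputable def children (G : SimpleGraph V) [G.LocallyFinite] (x z : V) : Finset V :=
  {w ∈ G.neighborFinset z | G.dist x w = G.dist x z + 1}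

open scoped Classical in
/-- The neighbours of `z` that are one step closer to `x`. -/
noncomputable def parents (G : SimpleGraph V) [G.LocallyFinite] (x z : V) : Finset V :=
  {v ∈ G.neighborFinset z | G.dist x z = G.dist x v + 1}

theorem mem_children {x z w : V} :
    w ∈ children G x z ↔ G.Adj z w ∧ G.dist x w = G.dist x z + 1 := by
  simp [children]

theorem mem_parents {x z v : V} :
    v ∈ parents G x z ↔ G.Adj z v ∧ G.dist x z = G.dist x v + 1 := by
  simp [parents]

theorem mem_parents_iff_mem_children {x z v : V} : v ∈ parents G x z ↔ z ∈ children G x v := by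
  rw [mem_parents, mem_children, G.adj_comm]

/-- The number of descendants of `z` after `n` generations, where each vertex is shared equally
between its parents. -/
noncomputable def descendantWeight (G : SimpleGraph V) [G.LocallyFinite] (x : V) : V → ℕ → ℝ
  | _, 0 => 1
  | z, n + 1 => ∑ w ∈ children G x z, ((parents G x w).card : ℝ)⁻¹ * descendantWeight G x w n

theorem PreservesLevels.descendantWeight_eq {δ : ℝ} {R : ℕ} (hconn : G.Connected)
    (hδ : IsDeltaHyperbolic G δ) (hR : δ + 1 ≤ R) {x y z : V} {φ : G ≃g G}
    (hφ : PreservesLevels G x y R φ) (hz : z ∈ cone G x y) (n : ℕ) :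
    descendantWeight G x (φ z) n = descendantWeight G x z n := by
  have hlevel : ∀ {a b}, a ∈ cone G x y → G.Adj a b →
      (G.dist x (φ b) : ℤ) - G.dist x (φ y) = (G.dist x b : ℤ) - G.dist x y :=
    fun ha hab => hφ.dist_eq_of_adj hconn hδ hR ha
      (hφ.map_mem_cone hconn hδ hR ha) hab
  have hself : ∀ {a}, a ∈ cone G x y →
      (G.dist x (φ a) : ℤ) - G.dist x (φ y) = (G.dist x a : ℤ) - G.dist x y := by
    intro a ha
    have h1 : G.dist x (φ a) = _ := hφ.map_mem_cone hconn hδ hR ha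
    have h2 : G.dist x a = _ := ha
    rw [dist_iso hconn] at h1
    omega
  have hchildren : ∀ {a}, a ∈ cone G x y →
      children G x (φ a) = (children G x a).map φ.toEquiv.toEmbedding := by
    intro a ha
    ext w
    obtain ⟨w, rfl⟩ := φ.surjective w
    have : φ w ∈ (children G x a).map φ.toEquiv.toEmbedding ↔ w ∈ children G x a :=
      Finset.mem_map' φ.toEquiv.toEmbedding
    rw [this, mem_children, mem_children, φ.map_adj_iff]
    refine and_congr_right fun haw => ?_
    have h1 := hlevel ha haw
    have h2 := hself ha
    omega
  have hparents : ∀ {a}, a ∈ cone G x y →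
      parents G x (φ a) = (parents G x a).map φ.toEquiv.toEmbedding := by
    intro a ha
    ext w
    obtain ⟨w, rfl⟩ := φ.surjective w
    have : φ w ∈ (parents G x a).map φ.toEquiv.toEmbedding ↔ w ∈ parents G x a :=
      Finset.mem_map' φ.toEquiv.toEmbedding
    rw [this, mem_parents, mem_parents, φ.map_adj_iff]
    refine and_congr_right fun haw => ?_
    have h1 := hlevel ha haw
    have h2 := hself ha
    omega
  induction n generalizing z with
  | zero => rw [descendantWeight, descendantWeight]
  | succ n ih =>
    rw [descendantWeight, descendantWeight, hchildren hz, Finset.sum_map]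
    refine Finset.sum_congr rfl fun w hw => ?_
    obtain ⟨hzw, hxw⟩ := mem_children.1 hw
    have hwc : w ∈ cone G x y := by
      have hz' : G.dist x z = G.dist x y + G.dist y z := hz
      have h1 : G.dist y w ≤ G.dist y z + G.dist z w := hconn.dist_triangle
      have h2 : G.dist x w ≤ G.dist x y + G.dist y w := hconn.dist_triangle
      rw [dist_eq_one_iff_adj.2 hzw] at h1
      change G.dist x w = _
      omega
    change ((parents G x (φ w)).card : ℝ)⁻¹ * descendantWeight G x (φ w) n = _
    rw [hparents hwc, Finset.card_map, ih hwc]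

/-- Only finitely many descendant weight sequences occur in a hyperbolike graph. -/
theorem finite_range_descendantWeight {δ : ℝ} (hG : Hyperbolike G δ) (x : V) :
    (Set.range (descendantWeight G x)).Finite := by
  obtain ⟨hconn, -, -, hδ, htrans⟩ := hG
  obtain ⟨R, hR⟩ := exists_nat_ge (δ + 1)
  choose ψ hψ using htrans x
  have hB : (ball G x R).Finite :=
    finite_ball hconn (fun v => Set.toFinite _) x R
  have : Finite (ball G x R) := hB
  let level : V → ball G x R → Set.Icc (-(R : ℤ)) R := fun y u =>
    ⟨(G.dist x (ψ y u) : ℤ) - G.dist x y, by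
      have hu : G.dist x u ≤ R := u.2
      have h0 := dist_iso hconn (ψ y) x u
      rw [hψ] at h0
      have h1 : G.dist x (ψ y u) ≤ G.dist x y + G.dist y (ψ y u) := hconn.dist_triangle
      have h2 : G.dist x y ≤ G.dist x (ψ y u) + G.dist (ψ y u) y := hconn.dist_triangle
      rw [G.dist_comm (u := ψ y u)] at h2
      constructor <;> omega⟩
  have hfactor : ∀ y y', level y = level y' →
      descendantWeight G x y = descendantWeight G x y' := by
    intro y y' h
    have hφy : ((ψ y).symm.trans (ψ y')) y = y' := by
      have : (ψ y).symm y = x := by rw [RelIso.symm_apply_eq, hψ]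
      rw [RelIso.trans_apply, this, hψ]
    have hφ : PreservesLevels G x y R ((ψ y).symm.trans (ψ y')) := by
      intro u hu
      have hu' : G.dist x ((ψ y).symm u) ≤ R := by
        rw [← dist_iso hconn (ψ y), hψ]; simpa using hu
      have h1 := congrArg Subtype.val (congrFun h ⟨(ψ y).symm u, hu'⟩)
      simp only [level, RelIso.apply_symm_apply] at h1
      rw [hφy, RelIso.trans_apply]
      exact h1.symm
    funext n
    have := hφ.descendantWeight_eq hconn hδ hR (z := y) (by simp [cone]) n
    rw [hφy] at this
    exact this.symm
  refine (Set.finite_range fun l : Set.range level => descendantWeight G x l.2.choose).subset ?_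
  rintro _ ⟨y, rfl⟩
  exact ⟨⟨level y, y, rfl⟩, hfactor _ _ (Set.mem_range_self (f := level) y).choose_spec⟩

/-- The descendants of `x` after `n` generations make up the sphere of radius `n`. -/
theorem descendantWeight_eq_card_sphere (hconn : G.Connected) (x : V) (n : ℕ) :
    descendantWeight G x x n = Nat.card {y | G.dist x y = n} := by
  have hfin : ∀ n, {y | G.dist x y = n}.Finite := fun n =>
    (finite_ball hconn (fun v => Set.toFinite _) x n).subset fun y hy => le_of_eq hy
  let S : ℕ → Finset V := fun n => (hfin n).toFinset
  have hS : ∀ {n y}, y ∈ S n ↔ G.dist x y = n := by simp [S]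
  have hstep : ∀ m n, ∑ y ∈ S m, descendantWeight G x y (n + 1) =
      ∑ w ∈ S (m + 1), descendantWeight G x w n := by
    intro m n
    simp_rw [descendantWeight]
    rw [Finset.sum_comm' (t' := S (m + 1)) (s' := fun w => parents G x w)]
    · refine Finset.sum_congr rfl fun w hw => ?_
      rw [Finset.sum_const, nsmul_eq_mul, ← mul_assoc, mul_inv_cancel₀, one_mul]
      have hne : G.dist x w ≠ 0 := by rw [hS.1 hw]; omega
      obtain ⟨v, hv, hvw⟩ := exists_adj_dist_add_one hconn hne
      exact Nat.cast_ne_zero.2 (Finset.card_ne_zero_of_mem (mem_parents.2 ⟨hv.symm, hvw.symm⟩))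
    · intro y w
      rw [mem_parents_iff_mem_children, hS, hS, mem_children]
      constructor
      · rintro ⟨h1, h2, h3⟩
        exact ⟨⟨h2, h3⟩, by omega⟩
      · rintro ⟨⟨h2, h3⟩, h1⟩
        exact ⟨by omega, h2, h3⟩
  have hall : ∀ k m, ∑ y ∈ S m, descendantWeight G x y k =
      ∑ y ∈ S (m + k), descendantWeight G x y 0 := by
    intro k
    induction k with
    | zero => intro m; rfl
    | succ k ih => intro m; rw [hstep, ih, add_right_comm, add_assoc]
  have h0 : S 0 = {x} := by
    ext y
    rw [hS, hconn.dist_eq_zero_iff, Finset.mem_singleton, eq_comm]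
  have h := hall n 0
  rw [h0, Finset.sum_singleton, zero_add] at h
  rw [h, Nat.card_coe_set_eq, Set.ncard_eq_toFinset_card _ (hfin n)]
  simp [descendantWeight, S]

end Weights

theorem card_ball_succ (hconn : G.Connected) (hfin : ∀ v, (G.neighborSet v).Finite) (x : V)
    (n : ℕ) :
    Nat.card (ball G x (n + 1)) = Nat.card (ball G x n) + Nat.card {y | G.dist x y = n + 1} := by
  simp only [Nat.card_coe_set_eq]
  rw [← Set.ncard_union_eq (s := ball G x n) (t := {y | G.dist x y = n + 1}) _
    (finite_ball hconn hfin x n) ((finite_ball hconn hfin x (n + 1)).subset fun y hy => le_of_eq hy)]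
  · congr 1
    ext y
    exact Nat.le_succ_iff
  · exact Set.disjoint_left.2 fun y (hy : G.dist x y ≤ n)
      (hy' : G.dist x y = n + 1) => by omega

end Rationality

/-- the growth series `b_x(t) = Σ |X_n| tⁿ` of a δ-hyperbolike graph
is a rational power series. -/
theorem rationality_of_growth_series {V : Type*} (G : SimpleGraph V) (δ : ℝ)
    (hG : Hyperbolike G δ) (x : V) :
    IsRationalPS (PowerSeries.mk fun n : ℕ => (Nat.card (ball G x n) : ℝ)) := by
  obtain ⟨hconn, ⟨D, hD⟩, -⟩ := id hG
  have hfin : ∀ v, (G.neighborSet v).Finite := fun v => (hD v).1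
  let : G.LocallyFinite := fun v => (hfin v).fintype
  let W : Submodule ℝ (ℕ → ℝ) := Submodule.span ℝ (Set.range (descendantWeight G x))
  have : FiniteDimensional ℝ W :=
    FiniteDimensional.span_of_finite ℝ (finite_range_descendantWeight hG x)
  have hW : ∀ s ∈ W, (fun n => s (n + 1)) ∈ W := by
    have hle : W ≤ W.comap (LinearMap.funLeft ℝ ℝ fun n : ℕ => n + 1) := by
      refine Submodule.span_le.2 ?_
      rintro _ ⟨y, rfl⟩
      have hshift : LinearMap.funLeft ℝ ℝ (fun n : ℕ => n + 1) (descendantWeight G x y) =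
          ∑ w ∈ children G x y, ((parents G x w).card : ℝ)⁻¹ • descendantWeight G x w := by
        funext n
        simp [LinearMap.funLeft_apply, descendantWeight]
      rw [SetLike.mem_coe, Submodule.mem_comap, hshift]
      exact W.sum_mem fun w _ => W.smul_mem _ (Submodule.subset_span ⟨w, rfl⟩)
    exact hle
  have hsphere := isRationalPS_of_mem_shift_invariant W hW
    (Submodule.subset_span ⟨x, rfl⟩ : descendantWeight G x x ∈ W)
  refine hsphere.partial_sums ?_ fun n => ?_
  · rw [descendantWeight_eq_card_sphere hconn]
    simp [ball]
  · rw [descendantWeight_eq_card_sphere hconn, card_ball_succ hconn hfin, Nat.cast_add]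

end CF
end

section
/- (Exponential growth.) Let X be a δ-hyperbolike graph with base vertex x which is nonelementary (X is infinite and not quasi-isometric to a point or a line). Then there are constants λ > 1 and C > 1 such that C⁻¹ λⁿ ≤ |X_n| ≤ C λⁿ for all n ≥ 0, where |X_n| is the number of vertices at distance at most n from x. -/
open SimpleGraph Filter

namespace CF

/-- Gromov's four point condition for the graph metric, with doubled constant `D`. -/
def FourPoint (G : SimpleGraph V) (D : ℕ) : Prop :=
  ∀ a b c w : V, G.dist w b + G.dist a c ≤ G.dist a b + G.dist w c + D ∨
    G.dist w b + G.dist a c ≤ G.dist b c + G.dist w a + D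

/-- Three points at distance `R` from `y` whose doubled pairwise Gromov products based at `y`
are at most `κ`. -/
def HasTripod (G : SimpleGraph V) (κ R : ℕ) (y : V) : Prop :=
  ∃ a b c : V, (G.dist y a = R ∧ G.dist y b = R ∧ G.dist y c = R) ∧
    2 * R ≤ G.dist a b + κ ∧ 2 * R ≤ G.dist b c + κ ∧ 2 * R ≤ G.dist a c + κ

theorem dist_map (G : SimpleGraph V) (hc : G.Connected) (φ : G ≃g G) (u v : V) :
    G.dist (φ u) (φ v) = G.dist u v := by
  have key : ∀ (ψ : G ≃g G) (a b : V), G.dist (ψ a) (ψ b) ≤ G.dist a b := by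
    intro ψ a b
    obtain ⟨p, hp⟩ := hc.exists_walk_length_eq_dist a b
    rw [← hp, ← Walk.length_map ψ.toHom p]
    exact dist_le _
  refine le_antisymm (key φ u v) ?_
  simpa using key φ.symm (φ u) (φ v)

theorem IsGeodesic.dist_getVert {G : SimpleGraph V} (hc : G.Connected) {u v : V}
    {p : G.Walk u v} (hp : IsGeodesic G p) {k : ℕ} (hk : k ≤ p.length) :
    G.dist u (p.getVert k) = k ∧ k + G.dist (p.getVert k) v = G.dist u v := by
  have h1 : G.dist u (p.getVert k) ≤ k := by
    have := dist_le (p.take k)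
    rw [Walk.take_length] at this
    omega
  have h2 : G.dist (p.getVert k) v ≤ p.length - k := by
    have := dist_le (p.drop k)
    rwa [Walk.drop_length] at this
  have h3 := hc.dist_triangle (u := u) (v := p.getVert k) (w := v)
  unfold IsGeodesic at hp
  omega

theorem IsGeodesic.dist_add_dist {G : SimpleGraph V} (hc : G.Connected) {u v z : V}
    {p : G.Walk u v} (hp : IsGeodesic G p) (hz : z ∈ p.support) :
    G.dist u z + G.dist z v = G.dist u v := by
  obtain ⟨k, rfl, hk⟩ := Walk.mem_support_iff_exists_getVert.1 hz
  have := hp.dist_getVert hc hk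
  omega

theorem exists_dist_eq {G : SimpleGraph V} (hc : G.Connected) (u v : V) {k : ℕ}
    (hk : k ≤ G.dist u v) : ∃ w, G.dist u w = k ∧ k + G.dist w v = G.dist u v := by
  obtain ⟨p, hp⟩ := hc.exists_walk_length_eq_dist u v
  exact ⟨p.getVert k, IsGeodesic.dist_getVert hc hp (by omega)⟩

/-- In a slim triangle, the distance from a vertex to the opposite side is at most the Gromov
product up to an additive constant. -/
theorem exists_mem_support_dist_le {G : SimpleGraph V} (hc : G.Connected) {d : ℕ} {a c w : V}
    (p : G.Walk a w) (q : G.Walk w c) (r : G.Walk a c) (hp : IsGeodesic G p)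
    (hq : IsGeodesic G q)
    (hslim : ∀ z ∈ r.support, ∃ y, (y ∈ p.support ∨ y ∈ q.support) ∧ G.dist z y ≤ d) :
    ∃ z ∈ r.support, 2 * G.dist w z + G.dist a c ≤ G.dist w a + G.dist w c + 4 * d + 2 := by
  have hstep : ∃ i ≤ r.length, ∃ y ∈ p.support, ∃ y' ∈ q.support,
      G.dist (r.getVert i) y ≤ d ∧ G.dist (r.getVert i) y' ≤ d + 1 := by
    by_contra! hcon
    have hall : ∀ i ≤ r.length, ∃ y ∈ p.support, G.dist (r.getVert i) y ≤ d := by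
      intro i
      induction i with
      | zero => exact fun _ => ⟨a, p.start_mem_support, by simp⟩
      | succ i ih =>
        intro hi
        obtain ⟨y, hy, hyd⟩ := ih (by omega)
        obtain ⟨y', hy' | hy', hyd'⟩ := hslim _ (r.getVert_mem_support (i + 1))
        · exact ⟨y', hy', hyd'⟩
        · have h1 := hcon i (by omega) y hy y' hy' hyd
          have h2 : G.dist (r.getVert i) (r.getVert (i + 1)) = 1 :=
            dist_eq_one_iff_adj.2 (r.adj_getVert_succ (by omega))
          have h3 := hc.dist_triangle (u := r.getVert i) (v := r.getVert (i + 1)) (w := y')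
          omega
    obtain ⟨y, hy, hyd⟩ := hall r.length le_rfl
    have := hcon r.length le_rfl y hy c q.end_mem_support hyd
    simp at this
  obtain ⟨i, hi, y, hy, y', hy', hyd, hyd'⟩ := hstep
  refine ⟨r.getVert i, r.getVert_mem_support i, ?_⟩
  generalize r.getVert i = z at *
  have e1 := hp.dist_add_dist hc hy
  have e2 := hq.dist_add_dist hc hy'
  have t1 := hc.dist_triangle (u := w) (v := y) (w := z)
  have t2 := hc.dist_triangle (u := w) (v := y') (w := z)
  have t3 := hc.dist_triangle (u := a) (v := y) (w := z)
  have t4 := hc.dist_triangle (u := z) (v := y') (w := c)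
  have t5 := hc.dist_triangle (u := a) (v := z) (w := c)
  have s1 := G.dist_comm (u := y) (v := z)
  have s2 := G.dist_comm (u := y') (v := z)
  have s3 := G.dist_comm (u := y) (v := w)
  have s4 := G.dist_comm (u := a) (v := w)
  omega

theorem two_mul_gromov_le {G : SimpleGraph V} (hc : G.Connected) {a b w z : V}
    (hz : G.dist a z + G.dist z b = G.dist a b) :
    G.dist w a + G.dist w b ≤ 2 * G.dist w z + G.dist a b := by
  have t1 := hc.dist_triangle (u := w) (v := z) (w := a)
  have t2 := hc.dist_triangle (u := w) (v := z) (w := b)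
  have s1 := G.dist_comm (u := z) (v := a)
  omega

theorem IsDeltaHyperbolic.fourPoint {G : SimpleGraph V} {δ : ℝ} (hc : G.Connected)
    (h : IsDeltaHyperbolic G δ) : FourPoint G (6 * ⌊δ⌋₊ + 2) := by
  intro a b c w
  have hle : ∀ {z y : V}, (G.dist z y : ℝ) ≤ δ → G.dist z y ≤ ⌊δ⌋₊ := fun hzy => Nat.le_floor hzy
  obtain ⟨p, hp⟩ := hc.exists_walk_length_eq_dist a w
  obtain ⟨q, hq⟩ := hc.exists_walk_length_eq_dist w c
  obtain ⟨r, hr⟩ := hc.exists_walk_length_eq_dist a c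
  obtain ⟨p', hp'⟩ := hc.exists_walk_length_eq_dist a b
  obtain ⟨q', hq'⟩ := hc.exists_walk_length_eq_dist b c
  obtain ⟨z, hz, hzd⟩ := exists_mem_support_dist_le (d := ⌊δ⌋₊) hc p q r hp hq
    (fun z hz => ((h p q r hp hq hr).2.2 z hz).imp fun y hy => ⟨hy.1, hle hy.2⟩)
  obtain ⟨y, hy, hyd⟩ := (h p' q' r hp' hq' hr).2.2 z hz
  replace hyd := hle hyd
  have t := hc.dist_triangle (u := w) (v := z) (w := y)
  rcases hy with hy | hy
  · have := two_mul_gromov_le hc (w := w) (IsGeodesic.dist_add_dist hc hp' hy)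
    left; omega
  · have := two_mul_gromov_le hc (w := w) (IsGeodesic.dist_add_dist hc hq' hy)
    right; omega

theorem two_mul_le_dist_of_nearest {G : SimpleGraph V} {D R : ℕ} (hc : G.Connected)
    (h4 : FourPoint G D) {p u y y' : V} (hu : G.dist p u = R) (hy' : G.dist p y' = R)
    (hy : R + G.dist y' y = G.dist p y)
    (hmin : ∀ q, G.dist p q + G.dist q u = G.dist p u → G.dist y p ≤ G.dist y q) :
    2 * R ≤ G.dist u y' + (2 * D + 1) := by
  by_contra! hcon
  have t := hc.dist_triangle (u := u) (v := y') (w := y)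
  have t2 := hc.dist_triangle (u := p) (v := u) (w := y)
  have t3 := hc.dist_triangle (u := p) (v := y) (w := u)
  have s1 := G.dist_comm (u := y) (v := u)
  have s2 := G.dist_comm (u := y) (v := p)
  have s5 := G.dist_comm (u := u) (v := p)
  have t4 := hc.dist_triangle (u := y) (v := u) (w := p)
  obtain ⟨q, hq1, hq2⟩ := exists_dist_eq hc p u (k := D + 1) (by omega)
  have hq := hmin q (by omega)
  have s3 := G.dist_comm (u := y) (v := q)
  rcases h4 q u y p with h | h <;> omega

/-- Without large tripods, every vertex is close to any geodesic interval whose ends are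
sufficiently far away. -/
theorem exists_near_interval {G : SimpleGraph V} {D R N : ℕ} (hc : G.Connected)
    (h4 : FourPoint G D) (hno : ∀ p, ¬ HasTripod G (2 * D + 1) R p) {u v x y : V}
    (hxu : G.dist u x = N) (hxv : G.dist x v = N) (huv : G.dist u v = 2 * N)
    (hN : R + 2 * G.dist x y ≤ N) :
    ∃ p, G.dist u p + G.dist p v = G.dist u v ∧ G.dist y p < R := by
  classical
  have hex : ∃ k p, G.dist u p + G.dist p v = G.dist u v ∧ G.dist y p = k :=
    ⟨_, x, by omega, rfl⟩
  obtain ⟨p, hp, hpk⟩ := Nat.find_spec hex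
  have hmin : ∀ q, G.dist u q + G.dist q v = G.dist u v → G.dist y p ≤ G.dist y q :=
    fun q hq => hpk ▸ Nat.find_min' hex ⟨q, hq, rfl⟩
  clear hpk hex
  refine ⟨p, hp, ?_⟩
  by_contra! hR
  refine hno p ?_
  have hpx := hmin x (by omega)
  have t1 := hc.dist_triangle (u := x) (v := y) (w := p)
  have t2 := hc.dist_triangle (u := u) (v := p) (w := x)
  have t3 := hc.dist_triangle (u := x) (v := p) (w := v)
  have s1 := G.dist_comm (u := x) (v := y)
  have s2 := G.dist_comm (u := x) (v := p)
  have s3 := G.dist_comm (u := p) (v := y)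
  have s4 := G.dist_comm (u := p) (v := u)
  obtain ⟨a, ha, ha'⟩ := exists_dist_eq hc p u (k := R) (by omega)
  obtain ⟨b, hb, hb'⟩ := exists_dist_eq hc p v (k := R) (by omega)
  obtain ⟨c, hc1, hc2⟩ := exists_dist_eq hc p y (k := R) (by omega)
  refine ⟨a, b, c, ⟨ha, hb, hc1⟩, ?_, ?_, ?_⟩
  · have t4 := hc.dist_triangle (u := u) (v := a) (w := v)
    have t5 := hc.dist_triangle (u := a) (v := b) (w := v)
    have s5 := G.dist_comm (u := u) (v := a)
    omega
  · refine two_mul_le_dist_of_nearest hc h4 hb hc1 hc2 fun q hq => hmin q ?_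
    have t4 := hc.dist_triangle (u := u) (v := p) (w := q)
    have t5 := hc.dist_triangle (u := u) (v := q) (w := v)
    have t6 := hc.dist_triangle (u := q) (v := b) (w := v)
    omega
  · refine two_mul_le_dist_of_nearest hc h4 ha hc1 hc2 fun q hq => hmin q ?_
    have t4 := hc.dist_triangle (u := q) (v := p) (w := v)
    have t5 := hc.dist_triangle (u := u) (v := q) (w := v)
    have t6 := hc.dist_triangle (u := u) (v := a) (w := q)
    have s5 := G.dist_comm (u := u) (v := a)
    have s6 := G.dist_comm (u := q) (v := p)
    have s7 := G.dist_comm (u := q) (v := a)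
    omega

theorem dist_le_of_mem_interval {G : SimpleGraph V} {D : ℕ} (h4 : FourPoint G D) {u v p q : V}
    (hp : G.dist u p + G.dist p v = G.dist u v) (hq : G.dist u q + G.dist q v = G.dist u v)
    (hle : G.dist u p ≤ G.dist u q) : G.dist p q + G.dist u p ≤ G.dist u q + D := by
  have s1 := G.dist_comm (u := v) (v := p)
  have s2 := G.dist_comm (u := p) (v := u)
  have s3 := G.dist_comm (u := v) (v := q)
  rcases h4 p v q u with h | h <;> omega

theorem ball_finite {G : SimpleGraph V} (hc : G.Connected) (hv : UnifFiniteValence G) (x : V)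
    (n : ℕ) : (ball G x n).Finite := by
  obtain ⟨B, hB⟩ := hv
  induction n with
  | zero =>
    refine (Set.finite_singleton x).subset fun y hy => ?_
    simpa [ball, hc.dist_eq_zero_iff, eq_comm] using hy
  | succ n ih =>
    refine (ih.union (ih.biUnion fun y _ => (hB y).1)).subset fun y hy => ?_
    change G.dist x y ≤ n + 1 at hy
    rcases Nat.lt_or_ge n (G.dist x y) with h | h
    · obtain ⟨w, hw, hw'⟩ := exists_dist_eq hc x y (k := n) (by omega)
      refine Or.inr (Set.mem_biUnion (show G.dist x w ≤ n from hw.le) ?_)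
      exact dist_eq_one_iff_adj.1 (by omega)
    · exact Or.inl h

theorem exists_dist_eq_of_infinite {G : SimpleGraph V} [Infinite V] (hc : G.Connected)
    (hb : ∀ x n, (ball G x n).Finite) (x : V) (n : ℕ) : ∃ y, G.dist x y = n := by
  obtain ⟨y, hy⟩ := (hb x n).exists_notMem
  obtain ⟨w, hw, -⟩ := exists_dist_eq hc x y (k := n) (le_of_not_ge hy)
  exact ⟨w, hw⟩

theorem exists_centered_interval {G : SimpleGraph V} [Infinite V] (hc : G.Connected)
    (hb : ∀ x n, (ball G x n).Finite) (ht : VertexTransitive G) (x : V) (N : ℕ) :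
    ∃ u v, G.dist u x = N ∧ G.dist x v = N ∧ G.dist u v = 2 * N := by
  obtain ⟨y, hy⟩ := exists_dist_eq_of_infinite hc hb x (2 * N)
  obtain ⟨w, hw, hw'⟩ := exists_dist_eq hc x y (k := N) (by omega)
  obtain ⟨φ, hφ⟩ := ht w x
  refine ⟨φ x, φ y, ?_, ?_, by rwa [dist_map G hc]⟩
  · rwa [← dist_map G hc φ, hφ] at hw
  · rw [← dist_map G hc φ w, hφ] at hw'
    omega

/-- A transitive hyperbolic graph without large tripods is quasi-isometric to the line: a limit of
horofunctions along longer and longer intervals centered at a base vertex is a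
quasi-isometry. -/
theorem quasiIsometricToReal_of_no_tripod {G : SimpleGraph V} [Infinite V] {D R : ℕ}
    (hc : G.Connected) (hb : ∀ x n, (ball G x n).Finite) (ht : VertexTransitive G)
    (h4 : FourPoint G D) (hno : ∀ p, ¬ HasTripod G (2 * D + 1) R p) :
    QuasiIsometricToReal G := by
  obtain ⟨x⟩ := hc.nonempty
  choose u v hu hv huv using exists_centered_interval hc hb ht x
  let U : Ultrafilter ℕ := hyperfilter ℕ
  have hlarge : ∀ n : ℕ, ∀ᶠ N in (U : Filter ℕ), n ≤ N := fun n =>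
    (eventually_ge_atTop n).filter_mono Nat.hyperfilter_le_atTop
  have hlim : ∀ y : V, ∃ k : ℤ, ∀ᶠ N in (U : Filter ℕ), (G.dist (u N) y : ℤ) - N = k := by
    intro y
    have := (Ultrafilter.eventually_exists_mem_iff (f := U)
      (P := fun (k : ℤ) N => (G.dist (u N) y : ℤ) - N = k)
      (Set.finite_Icc (-(G.dist x y : ℤ)) (G.dist x y))).1 (.of_forall fun N => ?_)
    · exact this.imp fun k hk => hk.2
    · refine ⟨_, ?_, rfl⟩
      have t1 := hc.dist_triangle (u := u N) (v := x) (w := y)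
      have t2 := hc.dist_triangle (u := u N) (v := y) (w := x)
      have s1 := G.dist_comm (u := x) (v := y)
      have := hu N
      simp only [Set.mem_Icc]
      omega
  choose f hf using hlim
  have hfar : ∀ y y' : V, |f y - f y'| ≤ G.dist y y' ∧
      (G.dist y y' : ℤ) ≤ |f y - f y'| + (4 * R + D) := by
    intro y y'
    obtain ⟨N, hy, hy', hN, hN'⟩ := ((hf y).and ((hf y').and
      ((hlarge (R + 2 * G.dist x y)).and (hlarge (R + 2 * G.dist x y'))))).exists
    obtain ⟨p, hp, hpy⟩ := exists_near_interval hc h4 hno (hu N) (hv N) (huv N) hN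
    obtain ⟨q, hq, hqy⟩ := exists_near_interval hc h4 hno (hu N) (hv N) (huv N) hN'
    have hsub : f y - f y' = (G.dist (u N) y : ℤ) - G.dist (u N) y' := by omega
    rw [hsub]
    have habs := abs_cases ((G.dist (u N) y : ℤ) - G.dist (u N) y')
    have t1 := hc.dist_triangle (u := u N) (v := y) (w := y')
    have t2 := hc.dist_triangle (u := u N) (v := y') (w := y)
    have t3 := hc.dist_triangle (u := y) (v := p) (w := y')
    have t4 := hc.dist_triangle (u := p) (v := q) (w := y')
    have t5 := hc.dist_triangle (u := u N) (v := y) (w := p)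
    have t6 := hc.dist_triangle (u := u N) (v := p) (w := y)
    have t7 := hc.dist_triangle (u := u N) (v := y') (w := q)
    have t8 := hc.dist_triangle (u := u N) (v := q) (w := y')
    have s1 := G.dist_comm (u := y) (v := y')
    have s2 := G.dist_comm (u := p) (v := y)
    have s3 := G.dist_comm (u := q) (v := y')
    have s4 := G.dist_comm (u := p) (v := q)
    rcases le_total (G.dist (u N) p) (G.dist (u N) q) with h | h
    · have := dist_le_of_mem_interval h4 hp hq h
      omega
    · have := dist_le_of_mem_interval h4 hq hp h
      omega
  have hsurj : ∀ k : ℤ, ∃ y, f y = k := by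
    intro k
    have := (Ultrafilter.eventually_exists_mem_iff (f := U)
      (P := fun y N => (G.dist (u N) y : ℤ) - N = k) (hb x k.natAbs)).1 ?_
    · obtain ⟨y, -, hy⟩ := this
      obtain ⟨N, h1, h2⟩ := (hy.and (hf y)).exists
      exact ⟨y, by omega⟩
    · filter_upwards [hlarge k.natAbs] with N hN
      have e1 := hu N
      have e2 := hv N
      have e3 := huv N
      have s1 := G.dist_comm (u := x) (v := u N)
      rcases le_total 0 k with hk | hk
      · obtain ⟨w, hw, hw'⟩ := exists_dist_eq hc x (v N) (k := k.natAbs) (by omega)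
        refine ⟨w, hw.le, ?_⟩
        have t1 := hc.dist_triangle (u := u N) (v := w) (w := v N)
        have t2 := hc.dist_triangle (u := u N) (v := x) (w := w)
        omega
      · obtain ⟨w, hw, hw'⟩ := exists_dist_eq hc x (u N) (k := k.natAbs) (by omega)
        refine ⟨w, hw.le, ?_⟩
        have s2 := G.dist_comm (u := w) (v := u N)
        omega
  have hC : (1 : ℝ) ≤ 4 * R + D + 1 := by
    linarith [R.cast_nonneg (α := ℝ), D.cast_nonneg (α := ℝ)]
  refine ⟨fun y => f y, 4 * R + D + 1, hC, fun y y' => ?_, fun r => ?_⟩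
  · have h1 : (|(f y : ℝ) - f y'|) ≤ G.dist y y' := by exact_mod_cast (hfar y y').1
    have h2 : (G.dist y y' : ℝ) ≤ |(f y : ℝ) - f y'| + (4 * R + D) := by
      exact_mod_cast (hfar y y').2
    have h0 : (0 : ℝ) ≤ G.dist y y' := Nat.cast_nonneg _
    have h3 := div_le_self h0 hC
    have h5 := le_mul_of_one_le_left h0 hC
    constructor <;> linarith
  · obtain ⟨y, hy⟩ := hsurj ⌊r⌋
    refine ⟨y, ?_⟩
    beta_reduce
    rw [hy, Int.self_sub_floor, abs_of_nonneg (Int.fract_nonneg r)]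
    linarith [Int.fract_lt_one r]

theorem HasTripod.map {G : SimpleGraph V} {κ R : ℕ} (hc : G.Connected) (φ : G ≃g G) {y : V}
    (h : HasTripod G κ R y) : HasTripod G κ R (φ y) := by
  obtain ⟨a, b, c, h⟩ := h
  exact ⟨φ a, φ b, φ c, by simpa only [dist_map G hc] using h⟩

/-- Given a tripod at `y`, at least two of its legs point away from `x`. -/
theorem HasTripod.exists_branching {G : SimpleGraph V} {D κ R : ℕ} (hc : G.Connected)
    (h4 : FourPoint G D) (hR : 3 * κ + 3 * D + 1 ≤ R) {y : V} (h : HasTripod G κ R y) (x : V) :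
    ∃ f : Bool → V, (∀ i, G.dist x (f i) = G.dist x y + (R - κ - D) ∧
      G.dist y (f i) ≤ R + κ + D) ∧ 2 * κ + 4 * D + 1 ≤ G.dist (f true) (f false) := by
  have key : ∀ a b, G.dist y a = R → G.dist y b = R → 2 * R ≤ G.dist a b + κ →
      G.dist x y + R ≤ G.dist x a + κ + D → G.dist x y + R ≤ G.dist x b + κ + D →
      ∃ f : Bool → V, (∀ i, G.dist x (f i) = G.dist x y + (R - κ - D) ∧
        G.dist y (f i) ≤ R + κ + D) ∧ 2 * κ + 4 * D + 1 ≤ G.dist (f true) (f false) := by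
    intro a b ha hb hab hxa hxb
    have t1 := hc.dist_triangle (u := x) (v := y) (w := a)
    have t2 := hc.dist_triangle (u := x) (v := y) (w := b)
    obtain ⟨a', ha1, ha2⟩ := exists_dist_eq hc x a (k := G.dist x y + (R - κ - D)) (by omega)
    obtain ⟨b', hb1, hb2⟩ := exists_dist_eq hc x b (k := G.dist x y + (R - κ - D)) (by omega)
    have t3 := hc.dist_triangle (u := a) (v := a') (w := b)
    have t4 := hc.dist_triangle (u := a') (v := b') (w := b)
    have t5 := hc.dist_triangle (u := y) (v := a) (w := a')
    have t6 := hc.dist_triangle (u := y) (v := b) (w := b')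
    have s1 := G.dist_comm (u := a) (v := a')
    have s2 := G.dist_comm (u := b) (v := b')
    refine ⟨fun i => cond i a' b', fun i => ?_, ?_⟩
    · cases i <;> simp only [cond_true, cond_false] <;> omega
    · simp only [cond_true, cond_false]; omega
  have pair : ∀ a b, G.dist y a = R → G.dist y b = R → 2 * R ≤ G.dist a b + κ →
      G.dist x y + R ≤ G.dist x a + κ + D ∨ G.dist x y + R ≤ G.dist x b + κ + D := by
    intro a b ha hb hab
    have s1 := G.dist_comm (u := x) (v := a)
    have s2 := G.dist_comm (u := x) (v := y)
    rcases h4 a x b y with h | h <;> omega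
  obtain ⟨a, b, c, ⟨ha, hb, hc'⟩, hab, hbc, hac⟩ := h
  rcases pair a b ha hb hab with h1 | h1
  · rcases pair b c hb hc' hbc with h2 | h2
    · exact key a b ha hb hab h1 h2
    · exact key a c ha hc' hac h1 h2
  · rcases pair a c ha hc' hac with h2 | h2
    · exact key a b ha hb hab h2 h1
    · exact key b c hb hc' hbc h1 h2

theorem exists_separated_finset {G : SimpleGraph V} {D κ R : ℕ} (hc : G.Connected)
    (h4 : FourPoint G D) (hR : 3 * κ + 3 * D + 1 ≤ R) (h : ∀ y, HasTripod G κ R y) (x : V)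
    (k : ℕ) : ∃ A : Finset V, (∀ y ∈ A, G.dist x y = k * (R - κ - D)) ∧
      (∀ y ∈ A, ∀ z ∈ A, y ≠ z → 2 * κ + 4 * D + 1 ≤ G.dist y z) ∧ 2 ^ k ≤ A.card := by
  classical
  induction k with
  | zero => exact ⟨{x}, by simp⟩
  | succ k ih =>
    obtain ⟨A, hA, hsep, hcard⟩ := ih
    choose f hf hf' using fun y => (h y).exists_branching hc h4 hR x
    have hsep' : ∀ y ∈ A, ∀ z ∈ A, ∀ i j, (y, i) ≠ (z, j) →
        2 * κ + 4 * D + 1 ≤ G.dist (f y i) (f z j) := by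
      intro y hy z hz i j hne
      by_cases hyz : y = z
      · subst hyz
        have hij : i ≠ j := fun e => hne (by rw [e])
        have := hf' y
        cases i <;> cases j <;> first | exact absurd rfl hij | exact this | rwa [G.dist_comm]
      · by_contra! hlt
        have h1 := hsep y hy z hz hyz
        have e1 := hA y hy
        have e2 := hA z hz
        obtain ⟨e3, e4⟩ := hf y i
        obtain ⟨e5, e6⟩ := hf z j
        have s1 := G.dist_comm (u := f y i) (v := z)
        have s2 := G.dist_comm (u := f z j) (v := z)
        have s3 := G.dist_comm (u := f y i) (v := y)
        generalize f y i = a at *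
        generalize f z j = b at *
        rcases h4 y a z x with h | h
        · omega
        · rcases h4 a b z x with h' | h' <;> omega
    refine ⟨(A ×ˢ (Finset.univ : Finset Bool)).image fun p => f p.1 p.2, ?_, ?_, ?_⟩
    · simp only [Finset.mem_image, Finset.mem_product, Finset.mem_univ, and_true, Prod.exists]
      rintro _ ⟨y, i, hy, rfl⟩
      rw [(hf y i).1, hA y hy, Nat.succ_mul]
    · simp only [Finset.mem_image, Finset.mem_product, Finset.mem_univ, and_true, Prod.exists]
      rintro _ ⟨y, i, hy, rfl⟩ _ ⟨z, j, hz, rfl⟩ hne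
      exact hsep' y hy z hz i j fun e => hne (by cases e; rfl)
    · rw [Finset.card_image_of_injOn, Finset.card_product, Finset.card_univ, Fintype.card_bool,
        pow_succ]
      · exact Nat.mul_le_mul_right 2 hcard
      · rintro ⟨y, i⟩ hy ⟨z, j⟩ hz heq
        by_contra hne
        have := hsep' y (by simpa using hy) z (by simpa using hz) i j hne
        simp only at heq
        rw [heq, SimpleGraph.dist_self] at this
        omega

/-- The sphere of radius `n` about `x`, as a finset. -/
noncomputable def sphereFinset {G : SimpleGraph V} (hb : ∀ x n, (ball G x n).Finite) (x : V)
    (n : ℕ) : Finset V :=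
  open Classical in (hb x n).toFinset.filter fun y => G.dist x y = n

theorem mem_sphereFinset {G : SimpleGraph V} (hb : ∀ x n, (ball G x n).Finite) {x y : V} {n : ℕ} :
    y ∈ sphereFinset hb x n ↔ G.dist x y = n := by
  simp only [sphereFinset, Finset.mem_filter, Set.Finite.mem_toFinset, ball, Set.mem_ofPred_eq]
  omega

/-- The number of vertices on the sphere of radius `n` about `x`. -/
noncomputable def growth {G : SimpleGraph V} (hb : ∀ x n, (ball G x n).Finite) (x : V)
    (n : ℕ) : ℕ :=
  (sphereFinset hb x n).card

theorem growth_eq {G : SimpleGraph V} (hc : G.Connected) (hb : ∀ x n, (ball G x n).Finite)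
    (ht : VertexTransitive G) (x y : V) (n : ℕ) : growth hb x n = growth hb y n := by
  have key : ∀ x y : V, growth hb x n ≤ growth hb y n := by
    intro x y
    obtain ⟨φ, rfl⟩ := ht x y
    refine Finset.card_le_card_of_injOn φ (fun z hz => ?_) φ.injective.injOn
    rw [Finset.mem_coe, mem_sphereFinset] at hz ⊢
    rwa [dist_map G hc]
  exact le_antisymm (key x y) (key y x)

theorem one_le_growth {G : SimpleGraph V} [Infinite V] (hc : G.Connected)
    (hb : ∀ x n, (ball G x n).Finite) (x : V) (n : ℕ) : 1 ≤ growth hb x n := by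
  obtain ⟨y, hy⟩ := exists_dist_eq_of_infinite hc hb x n
  exact Finset.card_pos.2 ⟨y, (mem_sphereFinset hb).2 hy⟩

theorem growth_add_le {G : SimpleGraph V} (hc : G.Connected) (hb : ∀ x n, (ball G x n).Finite)
    (ht : VertexTransitive G) (x : V) (n m : ℕ) :
    growth hb x (n + m) ≤ growth hb x n * growth hb x m := by
  classical
  refine (Finset.card_le_card (t := (sphereFinset hb x n).biUnion fun z => sphereFinset hb z m)
    fun y hy => ?_).trans (Finset.card_biUnion_le_card_mul _ _ _ fun z _ =>
      (growth_eq hc hb ht z x m).le)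
  rw [mem_sphereFinset] at hy
  obtain ⟨w, hw, hw'⟩ := exists_dist_eq hc x y (k := n) (by omega)
  refine Finset.mem_biUnion.2 ⟨w, (mem_sphereFinset hb).2 hw, (mem_sphereFinset hb).2 ?_⟩
  omega

theorem card_toFinset_ball {G : SimpleGraph V} (hb : ∀ x n, (ball G x n).Finite) (x : V) (n : ℕ) :
    (hb x n).toFinset.card = ∑ i ∈ Finset.range (n + 1), growth hb x i := by
  classical
  rw [Finset.card_eq_sum_card_fiberwise (f := fun y => G.dist x y) (t := Finset.range (n + 1))]
  · refine Finset.sum_congr rfl fun i hi => congrArg Finset.card ?_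
    ext y
    rw [Finset.mem_range] at hi
    simp only [mem_sphereFinset, Finset.mem_filter, Set.Finite.mem_toFinset, ball,
      Set.mem_ofPred_eq]
    omega
  · intro y hy
    simpa [ball, Nat.lt_succ_iff] using hy

theorem card_le_sum_growth {G : SimpleGraph V} (hc : G.Connected)
    (hb : ∀ x n, (ball G x n).Finite) (ht : VertexTransitive G) (x y : V) {n : ℕ} {A : Finset V}
    (hA : ∀ z ∈ A, G.dist y z < n) : A.card ≤ ∑ i ∈ Finset.range n, growth hb x i := by
  obtain _ | n := n
  · rw [Finset.eq_empty_of_forall_notMem fun z hz => Nat.not_lt_zero _ (hA z hz)]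
    simp
  · rw [Finset.sum_congr rfl fun i _ => growth_eq hc hb ht x y i, ← card_toFinset_ball hb y n]
    exact Finset.card_le_card fun z hz =>
      (Set.Finite.mem_toFinset _).2 (Nat.lt_succ_iff.1 (hA z hz))

/-- Few points of a sphere about `y` lie in the direction of `x` as seen from `y`. -/
theorem card_backward_le {G : SimpleGraph V} {D : ℕ} (hc : G.Connected)
    (hb : ∀ x n, (ball G x n).Finite) (ht : VertexTransitive G) (h4 : FourPoint G D) (x y : V)
    (j m : ℕ) : ((sphereFinset hb y m).filter fun w =>
      G.dist x w + 2 * (D + 1 + j) < G.dist x y + m).card ≤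
        ∑ i ∈ Finset.range (m - j), growth hb x i := by
  by_cases hk : D + 1 + j ≤ G.dist y x
  · obtain ⟨p, hp, hp'⟩ := exists_dist_eq hc y x hk
    refine card_le_sum_growth hc hb ht x p fun w hw => ?_
    rw [Finset.mem_filter, mem_sphereFinset] at hw
    have t := hc.dist_triangle (u := y) (v := x) (w := w)
    have t2 := hc.dist_triangle (u := x) (v := w) (w := y)
    have s1 := G.dist_comm (u := x) (v := y)
    have s2 := G.dist_comm (u := x) (v := p)
    have s3 := G.dist_comm (u := y) (v := w)
    have s4 := G.dist_comm (u := x) (v := w)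
    rcases h4 p x w y with h | h <;> omega
  · rw [Finset.card_eq_zero.2]
    · exact Nat.zero_le _
    · refine Finset.filter_eq_empty_iff.2 fun w hw => ?_
      rw [mem_sphereFinset] at hw
      have t := hc.dist_triangle (u := y) (v := x) (w := w)
      have s1 := G.dist_comm (u := x) (v := y)
      omega

theorem growth_mul_sub_le {G : SimpleGraph V} {D : ℕ} (hc : G.Connected)
    (hb : ∀ x n, (ball G x n).Finite) (ht : VertexTransitive G) (h4 : FourPoint G D) (x : V)
    (j n m : ℕ) :
    growth hb x n * (growth hb x m - ∑ i ∈ Finset.range (m - j), growth hb x i) ≤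
      (∑ i ∈ Finset.Icc (n + m - 2 * (D + 1 + j)) (n + m), growth hb x i) *
        ∑ i ∈ Finset.range (2 * (D + 1 + j) + D + 1), growth hb x i := by
  classical
  refine le_trans ?_ (Nat.mul_le_mul_right _ (Finset.card_biUnion_le
    (s := Finset.Icc (n + m - 2 * (D + 1 + j)) (n + m)) (t := sphereFinset hb x)))
  refine Finset.card_mul_le_card_mul (fun y w => G.dist y w = m) (fun y hy => ?_)
    (fun w hw => ?_)
  · rw [mem_sphereFinset] at hy
    have hback := card_backward_le hc hb ht h4 x y j m
    have hsplit := Finset.card_filter_add_card_filter_not (s := sphereFinset hb y m)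
      (fun w => G.dist x w + 2 * (D + 1 + j) < G.dist x y + m)
    have hS : (sphereFinset hb y m).card = growth hb x m := growth_eq hc hb ht y x m
    refine le_trans (b := ((sphereFinset hb y m).filter fun w =>
      ¬ G.dist x w + 2 * (D + 1 + j) < G.dist x y + m).card) (by omega) ?_
    refine Finset.card_le_card fun w hw => ?_
    rw [Finset.mem_filter, mem_sphereFinset] at hw
    have t := hc.dist_triangle (u := x) (v := y) (w := w)
    refine (Finset.mem_bipartiteAbove _).2 ⟨Finset.mem_biUnion.2 ⟨G.dist x w, ?_, ?_⟩, hw.1⟩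
    · rw [Finset.mem_Icc]; omega
    · rw [mem_sphereFinset]
  · obtain ⟨i, hi, hw⟩ := Finset.mem_biUnion.1 hw
    rw [mem_sphereFinset] at hw
    rw [Finset.mem_Icc] at hi
    obtain he | ⟨y₀, hy₀⟩ := (Finset.bipartiteBelow (fun y w => G.dist y w = m)
      (sphereFinset hb x n) w).eq_empty_or_nonempty
    · rw [he]; exact Nat.zero_le _
    · refine card_le_sum_growth hc hb ht x y₀ fun y hy => ?_
      rw [Finset.mem_bipartiteBelow, mem_sphereFinset] at hy hy₀
      have s1 := G.dist_comm (u := y₀) (v := y)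
      have s2 := G.dist_comm (u := y₀) (v := w)
      rcases h4 y w y₀ x with h | h <;> omega

theorem exists_two_pow_le_growth {G : SimpleGraph V} {D : ℕ} (hc : G.Connected)
    (hb : ∀ x n, (ball G x n).Finite) (ht : VertexTransitive G) (h4 : FourPoint G D) (x : V)
    (hne : Nonelementary G) : ∃ p, 0 < p ∧ ∀ k, 2 ^ k ≤ growth hb x (k * p) := by
  have := hne.1
  set κ := 2 * D + 1 with hκ
  set R := 3 * κ + 3 * D + 1 with hR
  obtain ⟨p, hp⟩ : ∃ p, HasTripod G κ R p := by
    by_contra! hno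
    exact hne.2 (quasiIsometricToReal_of_no_tripod hc hb ht h4 hno)
  refine ⟨R - κ - D, by omega, fun k => ?_⟩
  obtain ⟨A, hA, -, hcard⟩ := exists_separated_finset hc h4 hR.ge
    (fun y => by obtain ⟨φ, rfl⟩ := ht p y; exact hp.map hc φ) x k
  exact hcard.trans (Finset.card_le_card fun y hy => (mem_sphereFinset hb).2 (hA y hy))

/-- A submultiplicative sequence which is at least exponential along a progression and which is
almost supermultiplicative wherever it dominates its earlier partial sums is comparable to a
geometric sequence. -/
theorem exists_pow_le_and_le_mul_pow {s : ℕ → ℝ} (h1 : ∀ n, 1 ≤ s n)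
    (hsub : ∀ n m, s (n + m) ≤ s n * s m) {p : ℕ} (hp : 0 < p) (hexp : ∀ k, 2 ^ k ≤ s (k * p))
    (hsuper : ∀ j, ∃ (E : ℕ) (M : ℝ), 0 ≤ M ∧ ∀ n m,
      s n * (s m - ∑ i ∈ Finset.range (m - j), s i) ≤
        (∑ i ∈ Finset.Icc (n + m - E) (n + m), s i) * M) :
    ∃ lam c : ℝ, 1 < lam ∧ 0 < c ∧ ∀ n, lam ^ n ≤ s n ∧ s n ≤ c * lam ^ n := by
  have hpos : ∀ n, 0 < s n := fun n => one_pos.trans_le (h1 n)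
  have hu : Subadditive fun n => Real.log (s n) := fun m n => by
    rw [← Real.log_mul (hpos m).ne' (hpos n).ne']
    exact Real.log_le_log (hpos _) (hsub m n)
  have hbdd : BddBelow (Set.range fun n : ℕ => Real.log (s n) / n) :=
    ⟨0, by rintro _ ⟨n, rfl⟩; exact div_nonneg (Real.log_nonneg (h1 n)) n.cast_nonneg⟩
  have hlim := hu.tendsto_lim hbdd
  set L := hu.lim
  have hL : 0 < L := by
    refine lt_of_lt_of_le (b := Real.log 2 / p)
      (div_pos (Real.log_pos one_lt_two) (Nat.cast_pos.2 hp)) ?_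
    refine ge_of_tendsto (hlim.comp (tendsto_id.atTop_mul_const' hp)) ?_
    filter_upwards [eventually_gt_atTop 0] with k hk
    have hk' : (0 : ℝ) < k := Nat.cast_pos.2 hk
    have hp' : (0 : ℝ) < p := Nat.cast_pos.2 hp
    have := Real.log_le_log (by positivity) (hexp k)
    rw [Real.log_pow] at this
    simp only [Function.comp, id, Nat.cast_mul]
    rw [div_le_div_iff₀ hp' (by positivity)]
    nlinarith
  set lam := Real.exp L with hlam
  have hlam1 : 1 < lam := Real.one_lt_exp_iff.2 hL
  have hlam0 : 0 < lam := Real.exp_pos L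
  have hlower : ∀ n, lam ^ n ≤ s n := fun n => by
    rcases Nat.eq_zero_or_pos n with rfl | hn
    · simpa using h1 0
    · have := hu.lim_le_div hbdd hn.ne'
      rw [le_div_iff₀ (Nat.cast_pos.2 hn)] at this
      rw [hlam, ← Real.exp_nat_mul, ← Real.le_log_iff_exp_le (hpos n), mul_comm]
      exact this
  set a : ℕ → ℝ := fun n => s n / lam ^ n with ha
  have hsa : ∀ n, s n = a n * lam ^ n := fun n => (div_mul_cancel₀ _ (by positivity)).symm
  have ha1 : ∀ n, 1 ≤ a n := fun n => (one_le_div (by positivity)).2 (hlower n)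
  set B := partialSups a
  have haB : ∀ {i n}, i ≤ n → a i ≤ B n := fun h => le_partialSups_of_le a h
  have hB1 : ∀ n, 1 ≤ B n := fun n => (ha1 n).trans (haB le_rfl)
  have hBle : ∀ n c, (∀ i ≤ n, a i ≤ c) → B n ≤ c := fun n c h => partialSups_le a n c h
  obtain ⟨c, hc0, hc⟩ : ∃ c : ℝ, 0 < c ∧ ∀ n m, B n * B m ≤ c * B (n + m) := by
    obtain ⟨j, hj⟩ := pow_unbounded_of_one_lt (2 / (lam - 1)) hlam1
    rw [div_lt_iff₀ (by linarith)] at hj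
    obtain ⟨E, M, hM, hEM⟩ := hsuper j
    refine ⟨2 * ((E + 1) * M) + 1, by positivity, fun n₀ m₀ => ?_⟩
    obtain ⟨n, hn, hBn⟩ := exists_partialSups_eq a n₀
    obtain ⟨m, hm, hBm⟩ := exists_partialSups_eq a m₀
    have hrec : ∑ i ∈ Finset.range (m - j), s i ≤ s m / 2 := by
      rcases Nat.lt_or_ge m j with hmj | hmj
      · rw [Nat.sub_eq_zero_of_le hmj.le, Finset.sum_range_zero]
        linarith [hpos m]
      · have hle : ∑ i ∈ Finset.range (m - j), s i ≤
            a m * ∑ i ∈ Finset.range (m - j), lam ^ i := by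
          rw [Finset.mul_sum]
          refine Finset.sum_le_sum fun i hi => ?_
          rw [Finset.mem_range] at hi
          rw [hsa i, ← hBm]
          exact mul_le_mul_of_nonneg_right (haB (by omega)) (by positivity)
        refine hle.trans ?_
        rw [hsa m, mul_div_assoc]
        refine mul_le_mul_of_nonneg_left ?_ (by linarith [ha1 m])
        have hg := geom_sum_mul lam (m - j)
        have hpw : lam ^ (m - j) * lam ^ j = lam ^ m := by rw [← pow_add, Nat.sub_add_cancel hmj]
        have hQ : 0 ≤ ∑ i ∈ Finset.range (m - j), lam ^ i :=
          Finset.sum_nonneg fun i _ => (pow_pos hlam0 i).le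
        have hl : lam ^ (m - j) = (∑ i ∈ Finset.range (m - j), lam ^ i) * (lam - 1) + 1 := by
          linarith
        have hlj : 0 < lam ^ j := by positivity
        rw [← hpw, hl]
        nlinarith [mul_le_mul_of_nonneg_left hj.le hQ]
    have hIcc : ∑ i ∈ Finset.Icc (n + m - E) (n + m), s i ≤
        (E + 1) * (B (n₀ + m₀) * lam ^ (n + m)) := by
      refine (Finset.sum_le_card_nsmul _ _ (B (n₀ + m₀) * lam ^ (n + m)) fun i hi => ?_).trans ?_
      · rw [Finset.mem_Icc] at hi
        rw [hsa i]
        exact mul_le_mul (haB (by omega)) (pow_le_pow_right₀ hlam1.le hi.2) (by positivity)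
          (by linarith [hB1 (n₀ + m₀)])
      · rw [nsmul_eq_mul]
        refine mul_le_mul_of_nonneg_right ?_
          (mul_nonneg (by linarith [hB1 (n₀ + m₀)]) (by positivity))
        rw [Nat.card_Icc]
        exact_mod_cast (by omega : n + m + 1 - (n + m - E) ≤ E + 1)
    have hmain : s n * s m ≤ 2 * ((E + 1) * (B (n₀ + m₀) * lam ^ (n + m)) * M) := by
      have e1 := hEM n m
      have e2 := mul_le_mul_of_nonneg_right hIcc hM
      have e3 := mul_le_mul_of_nonneg_left hrec (hpos n).le
      linarith
    rw [hsa n, hsa m] at hmain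
    have hfac : a n * a m * lam ^ (n + m) ≤
        (2 * ((E + 1) * M) * B (n₀ + m₀)) * lam ^ (n + m) := by
      calc _ = a n * lam ^ n * (a m * lam ^ m) := by ring
        _ ≤ _ := hmain
        _ = _ := by ring
    have := le_of_mul_le_mul_right hfac (by positivity)
    rw [hBn, hBm]
    linarith [hB1 (n₀ + m₀)]
  have hBc : ∀ n, B n ≤ c := by
    intro n
    by_contra! hlt
    set ρ := B n / c
    have hρ : 1 < ρ := (one_lt_div hc0).2 hlt
    have hρB : ∀ k, ρ ^ k ≤ B (k * n) := by
      intro k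
      induction k with
      | zero => exact (pow_zero ρ).trans_le (hB1 _)
      | succ k ih =>
        have h2 : ρ * c = B n := div_mul_cancel₀ _ hc0.ne'
        have h3 := hc (k * n) n
        rw [← Nat.succ_mul] at h3
        rw [pow_succ]
        refine (mul_le_mul_of_nonneg_right ih (by linarith)).trans ?_
        rw [← h2] at h3
        nlinarith
    set ε := Real.log ρ / (n + 1) with hε
    have hn1 : (0 : ℝ) < n + 1 := by positivity
    have hε0 : 0 < ε := div_pos (Real.log_pos hρ) hn1
    obtain ⟨N, hN⟩ := eventually_atTop.1 (hlim.eventually_lt_const (lt_add_of_pos_right L hε0))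
    have haN : ∀ i, a i ≤ B N * Real.exp (ε * i) := by
      intro i
      have hexp1 : 1 ≤ Real.exp (ε * i) := Real.one_le_exp (by positivity)
      rcases le_or_gt i N with hi | hi
      · exact (haB hi).trans (le_mul_of_one_le_right (by linarith [hB1 N]) hexp1)
      · have hi0 : (0 : ℝ) < i := Nat.cast_pos.2 (by omega)
        have h2 := hN i hi.le
        rw [div_lt_iff₀ hi0, Real.log_lt_iff_lt_exp (hpos i), add_mul, Real.exp_add] at h2
        refine le_trans ?_ (le_mul_of_one_le_left (Real.exp_pos _).le (hB1 N))
        refine (div_le_iff₀ (by positivity)).2 ?_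
        rw [hlam, ← Real.exp_nat_mul, mul_comm (i : ℝ) L, mul_comm]
        exact h2.le
    have hBN : ∀ k : ℕ, ρ ^ k ≤ B N * Real.exp (ε * n) ^ k := by
      intro k
      refine (hρB k).trans (hBle _ _ fun i hi => (haN i).trans ?_)
      rw [← Real.exp_nat_mul]
      refine mul_le_mul_of_nonneg_left (Real.exp_le_exp.2 ?_) (by linarith [hB1 N])
      have : (i : ℝ) ≤ k * n := by exact_mod_cast hi
      nlinarith
    have hgap : Real.exp (ε * n) < ρ := by
      rw [← Real.lt_log_iff_exp_lt (by linarith)]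
      have : ε * (n + 1) = Real.log ρ := div_mul_cancel₀ _ hn1.ne'
      linarith
    obtain ⟨k, hk⟩ := pow_unbounded_of_one_lt (B N) ((one_lt_div (Real.exp_pos _)).2 hgap)
    rw [div_pow, lt_div_iff₀ (by positivity)] at hk
    exact absurd (hBN k) (not_le.2 hk)
  refine ⟨lam, c, hlam1, hc0, fun n => ⟨hlower n, ?_⟩⟩
  rw [hsa n]
  exact mul_le_mul_of_nonneg_right ((haB le_rfl).trans (hBc n)) (by positivity)

/-- Exponential growth: a nonelementary δ-hyperbolike graph satisfies
`C⁻¹ λⁿ ≤ |X_n| ≤ C λⁿ` for some `λ > 1`, `C > 1` and all `n ≥ 0`. -/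
theorem exponential_growth {V : Type*} (G : SimpleGraph V) (δ : ℝ)
    (hG : Hyperbolike G δ) (x : V) (hne : Nonelementary G) :
    ∃ lam C : ℝ, 1 < lam ∧ 1 < C ∧ ∀ n : ℕ,
      C⁻¹ * lam^n ≤ (Nat.card (ball G x n) : ℝ) ∧
      (Nat.card (ball G x n) : ℝ) ≤ C * lam^n := by
  obtain ⟨hc, hv, -, hδ, ht⟩ := hG
  have := hne.1
  have hb := ball_finite hc hv
  have h4 := hδ.fourPoint hc
  obtain ⟨p, hp, hexp⟩ := exists_two_pow_le_growth hc hb ht h4 x hne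
  obtain ⟨lam, c, hlam, hc0, hs⟩ := exists_pow_le_and_le_mul_pow
    (s := fun n => (growth hb x n : ℝ)) (fun n => by exact_mod_cast one_le_growth hc hb x n)
    (fun n m => by exact_mod_cast growth_add_le hc hb ht x n m) hp
    (fun k => by exact_mod_cast hexp k)
    (fun j => ⟨_, _, Nat.cast_nonneg _, fun n m => by
      have h := growth_mul_sub_le hc hb ht h4 x j n m
      have h' := Nat.mul_le_mul_left (growth hb x n) (Nat.sub_le_iff_le_add.1
        (le_refl (growth hb x m - ∑ i ∈ Finset.range (m - j), growth hb x i)))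
      rw [mul_sub, sub_le_iff_le_add]
      rw [mul_add] at h'
      exact_mod_cast h'.trans (Nat.add_le_add_right h _)⟩)
  have hcard : ∀ n, (Nat.card (ball G x n) : ℝ) =
      ∑ i ∈ Finset.range (n + 1), (growth hb x i : ℝ) := fun n => by
    rw [Nat.card_coe_set_eq, Set.ncard_eq_toFinset_card _ (hb x n), card_toFinset_ball]
    exact Nat.cast_sum _ _
  have hK : 0 < c * lam / (lam - 1) := div_pos (by positivity) (by linarith)
  refine ⟨lam, c * lam / (lam - 1) + 1, hlam, by linarith, fun n => ?_⟩
  have hpow : 0 < lam ^ n := by positivity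
  rw [hcard]
  constructor
  · refine (mul_le_of_le_one_left hpow.le (inv_le_one_of_one_le₀ (by linarith))).trans ?_
    exact (hs n).1.trans (Finset.single_le_sum (f := fun i => (growth hb x i : ℝ))
      (fun i _ => Nat.cast_nonneg _) (Finset.self_mem_range_succ n))
  · refine (Finset.sum_le_sum fun i _ => (hs i).2).trans ?_
    rw [← Finset.mul_sum, geom_sum_eq hlam.ne', pow_succ, add_mul, div_mul_eq_mul_div,
      mul_div_assoc', one_mul]
    refine (div_le_div_of_nonneg_right ?_ (by linarith)).trans (le_add_of_nonneg_right hpow.le)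
    linarith

end CF
end
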